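/- Let δ ≥ 0, let O₁, …, O_s be pairwise disjoint finite nonempty sets of points in EuclideanSpace ℝ (Fin d), let o_i := μ(O_i), and for each i let q_i be a point with ‖q_i − o_i‖ ≤ (1 + δ) · ρ(O_i). Then cost(O₁ ∪ ⋯ ∪ O_s, {q₁, …, q_s}) ≤ (1 + (1 + δ)²) · Σ_{i=1}^{s} cost(O_i, o_i). -/

import Mathlib

open Finset

/-- `cost Q c = ∑_{q ∈ Q} ‖q - c‖²` -/
noncomputable def cost {d : ℕ} (Q : Finset (EuclideanSpace ℝ (Fin d)))
    (c : EuclideanSpace ℝ (Fin d)) : ℝ := ∑ q ∈ Q, ‖q - c‖ ^ 2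

/-- `costS Q C = ∑_{q ∈ Q} min_{c ∈ C} ‖q - c‖²` (for nonempty `C`). -/
noncomputable def costS {d : ℕ} (Q C : Finset (EuclideanSpace ℝ (Fin d))) : ℝ :=
  ∑ q ∈ Q, sInf ((fun c => ‖q - c‖ ^ 2) '' (C : Set (EuclideanSpace ℝ (Fin d))))

/-- `mu Q` is the centroid (mean) of the finite set `Q`. -/
noncomputable def mu {d : ℕ} (Q : Finset (EuclideanSpace ℝ (Fin d))) :
    EuclideanSpace ℝ (Fin d) := (Q.card : ℝ)⁻¹ • ∑ q ∈ Q, q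

/-- The sum of the deviations from the centroid vanishes. -/
theorem sum_sub_mu {d : ℕ} (Q : Finset (EuclideanSpace ℝ (Fin d))) :
    ∑ x ∈ Q, (x - mu Q) = 0 := by
  rcases Q.eq_empty_or_nonempty with rfl | hQ
  · simp
  · have hcard : (Q.card : ℝ) ≠ 0 := by exact_mod_cast hQ.card_pos.ne'
    rw [Finset.sum_sub_distrib, Finset.sum_const, ← Nat.cast_smul_eq_nsmul ℝ, mu,
      smul_inv_smul₀ hcard, sub_self]

/-- The parallel axis identity for the cost of a finite set of points. -/
theorem cost_eq_cost_mu_add {d : ℕ} (Q : Finset (EuclideanSpace ℝ (Fin d)))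
    (c : EuclideanSpace ℝ (Fin d)) :
    cost Q c = cost Q (mu Q) + Q.card * ‖c - mu Q‖ ^ 2 := by
  have hexpand : ∀ x ∈ Q, ‖x - c‖ ^ 2 =
      ‖x - mu Q‖ ^ 2 - 2 * inner ℝ (x - mu Q) (c - mu Q) + ‖c - mu Q‖ ^ 2 := fun x _ => by
    rw [← sub_sub_sub_cancel_right x c (mu Q), norm_sub_sq_real]
  rw [cost, Finset.sum_congr rfl hexpand, Finset.sum_add_distrib, Finset.sum_sub_distrib,
    ← Finset.mul_sum, ← sum_inner, sum_sub_mu, inner_zero_left, Finset.sum_const, nsmul_eq_mul,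
    cost]
  ring

/-- Using all the centers of `C` costs no more than using any single one of them. -/
theorem costS_le_cost {d : ℕ} (Q : Finset (EuclideanSpace ℝ (Fin d)))
    {C : Finset (EuclideanSpace ℝ (Fin d))} {c : EuclideanSpace ℝ (Fin d)} (hc : c ∈ C) :
    costS Q C ≤ cost Q c :=
  Finset.sum_le_sum fun _ _ =>
    csInf_le (C.finite_toSet.image _).bddBelow (Set.mem_image_of_mem _ (Finset.mem_coe.2 hc))

/-- One δ-core point per cluster gives a `(1 + (1+δ)²)`-approximate set of centers for the
union of pairwise disjoint clusters `O₁, …, O_s`: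
`cost(O₁ ∪ ⋯ ∪ O_s, {q₁, …, q_s}) ≤ (1 + (1+δ)²) · Σᵢ cost(Oᵢ, μ(Oᵢ))`. -/
theorem cores_give_good_centers {d s : ℕ}
    [DecidableEq (EuclideanSpace ℝ (Fin d))] (hs : 0 < s) (δ : ℝ) (hδ : 0 ≤ δ)
    (O : Fin s → Finset (EuclideanSpace ℝ (Fin d)))
    (hOne : ∀ i, (O i).Nonempty)
    (hdisj : ∀ i j, i ≠ j → Disjoint (O i) (O j))
    (ρ : Fin s → ℝ) (hρ0 : ∀ i, 0 ≤ ρ i)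
    (hρ : ∀ i, (ρ i) ^ 2 * ((O i).card : ℝ) = cost (O i) (mu (O i)))
    (q : Fin s → EuclideanSpace ℝ (Fin d))
    (hq : ∀ i, ‖q i - mu (O i)‖ ≤ (1 + δ) * ρ i) :
    costS (Finset.univ.biUnion O) (Finset.univ.image q) ≤
      (1 + (1 + δ) ^ 2) * ∑ i, cost (O i) (mu (O i)) := by
  have hcluster : ∀ i, costS (O i) (Finset.univ.image q) ≤
      (1 + (1 + δ) ^ 2) * cost (O i) (mu (O i)) := fun i => by
    have hsq : ‖q i - mu (O i)‖ ^ 2 ≤ ((1 + δ) * ρ i) ^ 2 := by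
      gcongr
      exact hq i
    calc costS (O i) (Finset.univ.image q)
        ≤ cost (O i) (q i) :=
          costS_le_cost _ (Finset.mem_image_of_mem q (Finset.mem_univ i))
      _ = cost (O i) (mu (O i)) + (O i).card * ‖q i - mu (O i)‖ ^ 2 := cost_eq_cost_mu_add _ _
      _ ≤ cost (O i) (mu (O i)) + (O i).card * ((1 + δ) * ρ i) ^ 2 := by gcongr
      _ = (1 + (1 + δ) ^ 2) * cost (O i) (mu (O i)) := by rw [← hρ i]; ring
  calc costS (Finset.univ.biUnion O) (Finset.univ.image q)
      = ∑ i, costS (O i) (Finset.univ.image q) :=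
        Finset.sum_biUnion fun i _ j _ hij => hdisj i j hij
    _ ≤ ∑ i, (1 + (1 + δ) ^ 2) * cost (O i) (mu (O i)) :=
        Finset.sum_le_sum fun i _ => hcluster i
    _ = (1 + (1 + δ) ^ 2) * ∑ i, cost (O i) (mu (O i)) := (Finset.mul_sum _ _ _).symm
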